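/- The Markovian sub-statistics of a memoryless classical dynamics are compatible: for every pair of times i < j ≤ n and any two subsets Γ, Γ′ ⊆ {1,…,i−1} of earlier measured times with outcomes y_Γ and y′_{Γ′} respectively, the marginalised conditional probability of outcome x_j at time j given x_i at time i and y_Γ at Γ equals the marginalised conditional probability of x_j given x_i and y′_{Γ′} at Γ′, whenever both conditioning probabilities are positive. -/

import Mathlib

/-- The full joint probability of a memoryless classical dynamics on `n` times
(coordinate `i : Fin n` corresponds to time `i+1`) with initial probability vector
`p` and stochastic matrices `S 2, …, S n`:
`P(x_n,…,x_1) = (∏_{k=2}^{n} S_k(x_k, x_{k-1})) · p(x_1)`. -/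
def memorylessP {d n : ℕ} (hn : 0 < n) (p : Fin d → ℝ)
    (S : ℕ → Matrix (Fin d) (Fin d) ℝ) (x : Fin n → Fin d) : ℝ :=
  (∏ i : Fin n,
      if h : (i : ℕ) + 1 < n then S ((i : ℕ) + 2) (x ⟨(i : ℕ) + 1, h⟩) (x i) else 1)
    * p (x ⟨0, hn⟩)

/-- Replace the past (times before `i`) of `w` by that of `w'`. -/
def swPast {d n : ℕ} (i : Fin n) (w w' : Fin n → Fin d) : Fin n → Fin d :=
  fun k => if k < i then w' k else w k

theorem swPast_mul {d n : ℕ} (hn : 0 < n) (p : Fin d → ℝ)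
    (S : ℕ → Matrix (Fin d) (Fin d) ℝ) (i : Fin n) (w w' : Fin n → Fin d) (h : w i = w' i) :
    memorylessP hn p S w * memorylessP hn p S w' =
      memorylessP hn p S (swPast i w' w) * memorylessP hn p S (swPast i w w') := by
  unfold memorylessP
  refine (mul_mul_mul_comm _ _ _ _).trans (Eq.trans ?_ (mul_mul_mul_comm _ _ _ _).symm)
  rw [← Finset.prod_mul_distrib, ← Finset.prod_mul_distrib]
  congr 1
  · apply Finset.prod_congr rfl
    intro k _
    split_ifs with hk
    · unfold swPast
      by_cases h1 : k < i
      · by_cases h2 : (⟨(k : ℕ) + 1, hk⟩ : Fin n) < i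
        · simp only [h1, h2, if_true]
        · have h3 : (⟨(k : ℕ) + 1, hk⟩ : Fin n) = i := by
            apply Fin.ext
            simp only [Fin.lt_def] at h1 h2 ⊢
            omega
          simp only [h1, h3, h, lt_irrefl, if_true, if_false]
      · have h2 : ¬ (⟨(k : ℕ) + 1, hk⟩ : Fin n) < i := by
          simp only [Fin.lt_def] at h1 ⊢
          omega
        simp only [h1, h2, if_false]
        ring
    · rfl
  · unfold swPast
    split_ifs
    · rfl
    · ring

theorem swPast_swPast {d n : ℕ} (i : Fin n) (w w' : Fin n → Fin d) :
    swPast i (swPast i w w') (swPast i w' w) = w := by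
  funext k
  unfold swPast
  split_ifs <;> rfl

theorem swPast_ge {d n : ℕ} (i k : Fin n) (w w' : Fin n → Fin d) (h : i ≤ k) :
    swPast i w w' k = w k := if_neg (not_lt.mpr h)

theorem swPast_lt {d n : ℕ} (i k : Fin n) (w w' : Fin n → Fin d) (h : k < i) :
    swPast i w w' k = w' k := if_pos h

/-- The Markovian sub-statistics of a memoryless classical dynamics are compatible:
for times `i < j` and any two subsets `Γ, Γ'` of earlier measured times with
respective outcomes `y, y'`, the marginalised conditional probability of `x_j` at
time `j` given `x_i` at time `i` and `y` on `Γ` equals the marginalised conditional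
probability of `x_j` given `x_i` and `y'` on `Γ'`, whenever both conditioning
probabilities are positive. -/
theorem memoryless_classical_substatistics_compatible {d n : ℕ} (hn : 0 < n)
    (p : Fin d → ℝ) (S : ℕ → Matrix (Fin d) (Fin d) ℝ)
    (hp0 : ∀ y, 0 ≤ p y) (hp1 : ∑ y, p y = 1)
    (hS0 : ∀ k, 2 ≤ k → k ≤ n → ∀ a b, 0 ≤ S k a b)
    (hS1 : ∀ k, 2 ≤ k → k ≤ n → ∀ b, ∑ a, S k a b = 1)
    (i j : Fin n) (hij : i < j)
    (Γ Γ' : Finset (Fin n)) (hΓ : ∀ k ∈ Γ, k < i) (hΓ' : ∀ k ∈ Γ', k < i)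
    (y y' : Fin n → Fin d) (xi xj : Fin d)
    (hpos : 0 < ∑ w : Fin n → Fin d,
        if w i = xi ∧ ∀ k ∈ Γ, w k = y k then memorylessP hn p S w else 0)
    (hpos' : 0 < ∑ w : Fin n → Fin d,
        if w i = xi ∧ ∀ k ∈ Γ', w k = y' k then memorylessP hn p S w else 0) :
    (∑ w : Fin n → Fin d,
        if w j = xj ∧ w i = xi ∧ ∀ k ∈ Γ, w k = y k then memorylessP hn p S w else 0) /
      (∑ w : Fin n → Fin d,
        if w i = xi ∧ ∀ k ∈ Γ, w k = y k then memorylessP hn p S w else 0)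
    = (∑ w : Fin n → Fin d,
        if w j = xj ∧ w i = xi ∧ ∀ k ∈ Γ', w k = y' k then memorylessP hn p S w else 0) /
      (∑ w : Fin n → Fin d,
        if w i = xi ∧ ∀ k ∈ Γ', w k = y' k then memorylessP hn p S w else 0) := by
  rw [div_eq_div_iff hpos.ne' hpos'.ne', Fintype.sum_mul_sum, Fintype.sum_mul_sum,
    ← Fintype.sum_prod_type', ← Fintype.sum_prod_type']
  let e : Equiv ((Fin n → Fin d) × (Fin n → Fin d)) ((Fin n → Fin d) × (Fin n → Fin d)) :=
    { toFun := fun q => (swPast i q.1 q.2, swPast i q.2 q.1)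
      invFun := fun q => (swPast i q.1 q.2, swPast i q.2 q.1)
      left_inv := fun q => Prod.ext (swPast_swPast i q.1 q.2) (swPast_swPast i q.2 q.1)
      right_inv := fun q => Prod.ext (swPast_swPast i q.1 q.2) (swPast_swPast i q.2 q.1) }
  refine Fintype.sum_equiv e _ _ ?_
  rintro ⟨w, w'⟩
  have hA : (∀ k ∈ Γ', swPast i w w' k = y' k) ↔ ∀ k ∈ Γ', w' k = y' k :=
    forall₂_congr fun k hk => by rw [swPast_lt i k w w' (hΓ' k hk)]
  have hB : (∀ k ∈ Γ, swPast i w' w k = y k) ↔ ∀ k ∈ Γ, w k = y k :=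
    forall₂_congr fun k hk => by rw [swPast_lt i k w' w (hΓ k hk)]
  simp only [e, Equiv.coe_fn_mk, hA, hB, swPast_ge i j _ _ hij.le, swPast_ge i i _ _ le_rfl]
  by_cases h1 : w i = xi
  · by_cases h2 : w' i = xi
    · have hm := swPast_mul hn p S i w w' (h1.trans h2.symm)
      rw [mul_comm (memorylessP hn p S (swPast i w' w))] at hm
      by_cases h3 : w j = xj <;> by_cases h4 : ∀ k ∈ Γ, w k = y k <;>
        by_cases h5 : ∀ k ∈ Γ', w' k = y' k <;>
        simp only [h1, h2, h3, h4, h5, and_self, true_and, and_false, false_and,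
          if_false, mul_zero, zero_mul]
      rw [if_pos h4, if_pos h5, if_pos h5, if_pos h4]
      exact hm
    · simp [h2]
  · simp [h1]
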